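/- arXiv:1804.04290 — 2 statements merged into one kernel-verified Lean document; each statement's English description precedes it below -/
import Mathlib

section
/- Consider the closed-loop single-master–N-slaves teleoperation system under Round-Robin scheduling. Assume the robot properties P1–P3, the closed-loop RR dynamics for all t ≥ t₀ with measurable bounded delays, and the LMI feasibility condition. If the external forces f_m, f_{s1}, …, f_{sN} are bounded on [t₀, ∞) (i.e. belong to L^∞), then the velocities q̇_m(t) and q̇_{si}(t), i = 1,…,N, are bounded on [t₀, ∞). -/
open Matrix MeasureTheory Filter Set Finset

noncomputable section

/-- Property P1: the inertia matrix is continuously differentiable (entrywise),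
symmetric-valued, and uniformly bounded below and above by positive multiples of
the identity. -/
def PropP1 {n : ℕ} (M : (Fin n → ℝ) → Matrix (Fin n) (Fin n) ℝ) : Prop :=
  (∀ i j, ContDiff ℝ 1 (fun p : Fin n → ℝ => M p i j)) ∧
  (∀ q, (M q).IsSymm) ∧
  ∃ lm lM : ℝ, 0 < lm ∧ lm ≤ lM ∧
    ∀ q, (M q - lm • (1 : Matrix (Fin n) (Fin n) ℝ)).PosSemidef ∧
      (lM • (1 : Matrix (Fin n) (Fin n) ℝ) - M q).PosSemidef

/-- Property P2: the Coriolis matrix is continuous and, along every C¹ curve,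
d/dt[M(q(t))] - 2 C(q(t), q̇(t)) is skew-symmetric. -/
def PropP2 {n : ℕ} (M : (Fin n → ℝ) → Matrix (Fin n) (Fin n) ℝ)
    (C : (Fin n → ℝ) → (Fin n → ℝ) → Matrix (Fin n) (Fin n) ℝ) : Prop :=
  (∀ i j, Continuous (fun p : (Fin n → ℝ) × (Fin n → ℝ) => C p.1 p.2 i j)) ∧
  ∀ q : ℝ → Fin n → ℝ, ContDiff ℝ 1 q → ∀ t : ℝ,
    (Matrix.of (fun i j => deriv (fun s => M (q s) i j) t)
        - (2 : ℝ) • C (q t) (deriv q t))ᵀ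
      = -(Matrix.of (fun i j => deriv (fun s => M (q s) i j) t)
        - (2 : ℝ) • C (q t) (deriv q t))

/-- Property P3: |C(q,x)·y| ≤ c·|x|·|y|. -/
def PropP3 {n : ℕ}
    (C : (Fin n → ℝ) → (Fin n → ℝ) → Matrix (Fin n) (Fin n) ℝ) : Prop :=
  ∃ c : ℝ, 0 < c ∧ ∀ q x y : Fin n → ℝ, ‖(C q x).mulVec y‖ ≤ c * ‖x‖ * ‖y‖

/-- Property P4: along every curve with bounded velocity and acceleration,
t ↦ C(q(t), q̇(t)) is differentiable with bounded derivative. -/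
def PropP4 {n : ℕ}
    (C : (Fin n → ℝ) → (Fin n → ℝ) → Matrix (Fin n) (Fin n) ℝ) : Prop :=
  ∀ q : ℝ → Fin n → ℝ, ContDiff ℝ 2 q →
    (∃ b, ∀ t, ‖deriv q t‖ ≤ b) → (∃ b, ∀ t, ‖deriv (deriv q) t‖ ≤ b) →
    (∀ i j, Differentiable ℝ (fun t => C (q t) (deriv q t) i j)) ∧
    ∃ b, ∀ t i j, |deriv (fun s => C (q s) (deriv q s) i j) t| ≤ b

/-- The 4n×4n block matrix Π of the Round-Robin LMI, with diagonal blocks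
−2Kᵈ + h_M·R_m, −2Kᵈ + h_S·R_s, −h_M⁻¹·R_m, −h_S⁻¹·R_s and off-diagonal blocks
(1,4) = (2,3) = −Kᵖ (together with their symmetric counterparts). -/
def PiRR {n : ℕ} (hM hS : ℝ) (Kp Kd Rm Rs : Matrix (Fin n) (Fin n) ℝ) :
    Matrix (Fin 4 × Fin n) (Fin 4 × Fin n) ℝ :=
  Matrix.of fun p q =>
    (!![(-2:ℝ) • Kd + hM • Rm, 0, 0, -Kp;
        0, (-2:ℝ) • Kd + hS • Rs, -Kp, 0;
        0, -Kp, -(hM⁻¹) • Rm, 0;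
        -Kp, 0, 0, -(hS⁻¹) • Rs] p.1 q.1) p.2 q.2

lemma HasDerivAt.dotProduct_vec {n : ℕ} {x y : ℝ → Fin n → ℝ} {x' y' : Fin n → ℝ} {t : ℝ}
    (hx : HasDerivAt x x' t) (hy : HasDerivAt y y' t) :
    HasDerivAt (fun s => x s ⬝ᵥ y s) (x' ⬝ᵥ y t + x t ⬝ᵥ y') t := by
  simp only [dotProduct, ← Finset.sum_add_distrib]
  exact HasDerivAt.fun_sum fun i _ => ((hasDerivAt_pi.1 hx) i).mul ((hasDerivAt_pi.1 hy) i)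

lemma HasDerivAt.mulVec_vec {n : ℕ} {M : ℝ → Matrix (Fin n) (Fin n) ℝ} {x : ℝ → Fin n → ℝ}
    {M' : Matrix (Fin n) (Fin n) ℝ} {x' : Fin n → ℝ} {t : ℝ}
    (hM : ∀ i j, HasDerivAt (fun s => M s i j) (M' i j) t) (hx : HasDerivAt x x' t) :
    HasDerivAt (fun s => M s *ᵥ x s) (M t *ᵥ x' + M' *ᵥ x t) t := by
  refine hasDerivAt_pi.2 fun i => ?_
  have h := HasDerivAt.dotProduct_vec (hasDerivAt_pi.2 (hM i)) hx
  rw [add_comm] at h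
  exact h

lemma HasDerivAt.const_mulVec {n : ℕ} (A : Matrix (Fin n) (Fin n) ℝ) {x : ℝ → Fin n → ℝ}
    {x' : Fin n → ℝ} {t : ℝ} (hx : HasDerivAt x x' t) :
    HasDerivAt (fun s => A *ᵥ x s) (A *ᵥ x') t := by
  have h := HasDerivAt.mulVec_vec (M := fun _ => A) (M' := 0) (t := t)
    (fun i j => hasDerivAt_const t (A i j)) hx
  simpa using h

lemma Matrix.IsSymm.dotProduct_mulVec_comm {ι : Type*} [Fintype ι] {A : Matrix ι ι ℝ}
    (hA : A.IsSymm) (x y : ι → ℝ) : x ⬝ᵥ A *ᵥ y = y ⬝ᵥ A *ᵥ x := by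
  rw [dotProduct_mulVec, ← mulVec_transpose, hA.eq, dotProduct_comm]

lemma Matrix.PosDef.isSymm_real {ι : Type*} {A : Matrix ι ι ℝ} (hA : A.PosDef) : A.IsSymm := by
  have h := hA.isHermitian
  rwa [Matrix.IsHermitian, conjTranspose_eq_transpose_of_trivial] at h

lemma dotProduct_self_nonneg_real {ι : Type*} [Fintype ι] (x : ι → ℝ) : 0 ≤ x ⬝ᵥ x :=
  Finset.sum_nonneg fun i _ => mul_self_nonneg (x i)

/-- A positive definite real matrix is coercive. -/
lemma Matrix.PosDef.exists_coercive {ι : Type*} [Fintype ι] {A : Matrix ι ι ℝ} (hA : A.PosDef) :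
    ∃ k > 0, ∀ x : ι → ℝ, k * (x ⬝ᵥ x) ≤ x ⬝ᵥ A *ᵥ x := by
  have hcont : Continuous fun x : ι → ℝ => x ⬝ᵥ A *ᵥ x := by
    unfold dotProduct mulVec dotProduct; fun_prop
  have hcont' : Continuous fun x : ι → ℝ => x ⬝ᵥ x := by
    unfold dotProduct; fun_prop
  have hpos : ∀ x : ι → ℝ, x ≠ 0 → 0 < x ⬝ᵥ A *ᵥ x := fun x hx => by
    simpa using hA.dotProduct_mulVec_pos hx
  have hself : ∀ x : ι → ℝ, x ≠ 0 → 0 < x ⬝ᵥ x := fun x hx =>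
    lt_of_le_of_ne (dotProduct_self_nonneg_real x) fun h => hx (dotProduct_self_eq_zero.1 h.symm)
  have hs : ∀ x ∈ Metric.sphere (0 : ι → ℝ) 1, x ≠ 0 := fun x hx h => by simp [h] at hx
  rcases (Metric.sphere (0 : ι → ℝ) 1).eq_empty_or_nonempty with he | hne
  · refine ⟨1, one_pos, fun x => ?_⟩
    by_cases hx : x = 0
    · simp [hx]
    · have : ‖x‖⁻¹ • x ∈ Metric.sphere (0 : ι → ℝ) 1 := by
        simp [norm_smul, norm_ne_zero_iff.2 hx]
      simp [he] at this
  · obtain ⟨u, hu, humin⟩ := (isCompact_sphere (0 : ι → ℝ) 1).exists_isMinOn hne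
      (f := fun x => (x ⬝ᵥ A *ᵥ x) / (x ⬝ᵥ x))
      (hcont.continuousOn.div hcont'.continuousOn fun x hx => (hself x (hs x hx)).ne')
    refine ⟨_, div_pos (hpos u (hs u hu)) (hself u (hs u hu)), fun x => ?_⟩
    by_cases hx : x = 0
    · simp [hx]
    · have hm : ‖x‖⁻¹ • x ∈ Metric.sphere (0 : ι → ℝ) 1 := by
        simp [norm_smul, norm_ne_zero_iff.2 hx]
      have h := humin hm
      have hx' : ‖x‖ ≠ 0 := norm_ne_zero_iff.2 hx
      simp only [mem_ofPred_eq, mulVec_smul, dotProduct_smul, smul_dotProduct, smul_eq_mul] at h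
      rw [← mul_assoc, ← mul_assoc, mul_div_mul_left _ _ (by positivity)] at h
      exact (le_div_iff₀ (hself x hx)).1 h

lemma Matrix.exists_quadratic_bound {n : ℕ} (A : Matrix (Fin n) (Fin n) ℝ) :
    ∃ K > 0, ∀ x : Fin n → ℝ, x ⬝ᵥ A *ᵥ x ≤ K * (x ⬝ᵥ x) := by
  refine ⟨∑ i, ∑ j, |A i j| + 1, by positivity, fun x => ?_⟩
  have hx : ∀ i, x i * x i ≤ x ⬝ᵥ x := fun i =>
    Finset.single_le_sum (f := fun i => x i * x i) (fun i _ => mul_self_nonneg (x i))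
      (Finset.mem_univ i)
  have h : x ⬝ᵥ A *ᵥ x ≤ (∑ i, ∑ j, |A i j|) * (x ⬝ᵥ x) := by
    have he : x ⬝ᵥ A *ᵥ x = ∑ i, ∑ j, x i * (A i j * x j) := by
      simp only [dotProduct, mulVec, Finset.mul_sum]
    rw [he, Finset.sum_mul]
    refine Finset.sum_le_sum fun i _ => ?_
    rw [Finset.sum_mul]
    refine Finset.sum_le_sum fun j _ => ?_
    have h1 : |x i * x j| ≤ x ⬝ᵥ x := by
      rw [abs_le]
      constructor <;> nlinarith [hx i, hx j, sq_nonneg (x i + x j), sq_nonneg (x i - x j)]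
    calc x i * (A i j * x j) = A i j * (x i * x j) := by ring
      _ ≤ |A i j| * |x i * x j| := by rw [← abs_mul]; exact le_abs_self _
      _ ≤ _ := mul_le_mul_of_nonneg_left h1 (abs_nonneg _)
  nlinarith [dotProduct_self_nonneg_real x]

/-- Cauchy–Schwarz for a positive semidefinite form bounded by `l` times the identity. -/
lemma abs_dotProduct_mulVec_le {n : ℕ} {A : Matrix (Fin n) (Fin n) ℝ} (hA : A.IsSymm) {l : ℝ}
    (h0 : ∀ x : Fin n → ℝ, 0 ≤ x ⬝ᵥ A *ᵥ x) (h1 : ∀ x : Fin n → ℝ, x ⬝ᵥ A *ᵥ x ≤ l * (x ⬝ᵥ x))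
    (x y : Fin n → ℝ) : |x ⬝ᵥ A *ᵥ y| ≤ l / 2 * (x ⬝ᵥ x + y ⬝ᵥ y) := by
  have hp := h0 (x + y)
  have hm := h0 (x - y)
  have hs := hA.dotProduct_mulVec_comm y x
  simp only [mulVec_add, mulVec_sub, dotProduct_add, dotProduct_sub, add_dotProduct,
    sub_dotProduct] at hp hm
  rw [abs_le]
  constructor <;> linarith [h1 x, h1 y]

lemma two_mul_dotProduct_le {n : ℕ} {ε : ℝ} (hε : 0 < ε) (x y : Fin n → ℝ) :
    2 * (x ⬝ᵥ y) ≤ ε * (x ⬝ᵥ x) + ε⁻¹ * (y ⬝ᵥ y) := by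
  have h := dotProduct_self_nonneg_real (ε • x - y)
  simp only [dotProduct_sub, sub_dotProduct, dotProduct_smul, smul_dotProduct, smul_eq_mul,
    dotProduct_comm y x] at h
  have h2 := mul_nonneg (inv_nonneg.2 hε.le) h
  have h3 : ε⁻¹ * (ε * (ε * x ⬝ᵥ x) - ε * x ⬝ᵥ y - (ε * x ⬝ᵥ y - y ⬝ᵥ y))
      = ε * (x ⬝ᵥ x) + ε⁻¹ * (y ⬝ᵥ y) - 2 * (x ⬝ᵥ y) := by
    field_simp; ring
  linarith

lemma norm_sq_le_dotProduct {n : ℕ} (x : Fin n → ℝ) : ‖x‖ ^ 2 ≤ x ⬝ᵥ x := by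
  have h : ‖x‖ ≤ √(x ⬝ᵥ x) := by
    rw [pi_norm_le_iff_of_nonneg (Real.sqrt_nonneg _)]
    intro i
    rw [Real.norm_eq_abs]
    refine Real.abs_le_sqrt ?_
    rw [sq]
    exact Finset.single_le_sum (f := fun i => x i * x i) (fun i _ => mul_self_nonneg (x i))
      (Finset.mem_univ i)
  calc ‖x‖ ^ 2 ≤ √(x ⬝ᵥ x) ^ 2 := by gcongr
    _ = _ := Real.sq_sqrt (dotProduct_self_nonneg_real x)

lemma abs_dotProduct_le_norm {n : ℕ} (x y : Fin n → ℝ) : |x ⬝ᵥ y| ≤ n * (‖x‖ * ‖y‖) := by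
  calc |x ⬝ᵥ y| ≤ ∑ i, |x i * y i| := Finset.abs_sum_le_sum_abs _ _
    _ ≤ ∑ _i : Fin n, ‖x‖ * ‖y‖ := by
        refine Finset.sum_le_sum fun i _ => ?_
        rw [abs_mul]
        exact mul_le_mul (norm_le_pi_norm x i) (norm_le_pi_norm y i) (abs_nonneg _) (norm_nonneg _)
    _ = _ := by simp

lemma dotProduct_self_le_of_norm_le {n : ℕ} {x : Fin n → ℝ} {b : ℝ} (h : ‖x‖ ≤ b) :
    x ⬝ᵥ x ≤ n * b ^ 2 := by
  refine (le_abs_self _).trans ((abs_dotProduct_le_norm x x).trans ?_)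
  rw [← sq]
  gcongr

lemma PropP1.exists_bounds {n : ℕ} {M : (Fin n → ℝ) → Matrix (Fin n) (Fin n) ℝ} (h : PropP1 M) :
    ∃ lm lM : ℝ, 0 < lm ∧ 0 < lM ∧ ∀ q x, lm * (x ⬝ᵥ x) ≤ x ⬝ᵥ M q *ᵥ x ∧
      x ⬝ᵥ M q *ᵥ x ≤ lM * (x ⬝ᵥ x) := by
  obtain ⟨-, -, lm, lM, hlm, hle, hb⟩ := h
  refine ⟨lm, lM, hlm, hlm.trans_le hle, fun q x => ⟨?_, ?_⟩⟩
  · have h := (hb q).1.dotProduct_mulVec_nonneg x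
    simp only [star_trivial, sub_mulVec, smul_mulVec, one_mulVec, dotProduct_sub,
      dotProduct_smul, smul_eq_mul] at h
    linarith
  · have h := (hb q).2.dotProduct_mulVec_nonneg x
    simp only [star_trivial, sub_mulVec, smul_mulVec, one_mulVec, dotProduct_sub,
      dotProduct_smul, smul_eq_mul] at h
    linarith

lemma ContDiff.hasDerivAt_vec {n : ℕ} {q : ℝ → Fin n → ℝ} (hq : ContDiff ℝ 2 q) (t : ℝ) :
    HasDerivAt q (deriv q t) t :=
  (hq.differentiable (by norm_num)).differentiableAt.hasDerivAt

lemma ContDiff.hasDerivAt_deriv_vec {n : ℕ} {q : ℝ → Fin n → ℝ} (hq : ContDiff ℝ 2 q) (t : ℝ) :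
    HasDerivAt (deriv q) (deriv (deriv q) t) t := by
  have h : ContDiff ℝ 1 (deriv q) := ((contDiff_succ_iff_deriv (n := 1)).1 hq).2.2
  exact (h.differentiable (by norm_num)).differentiableAt.hasDerivAt

/-- Rate of change of the generalized momentum `M(q) q̇`. -/
lemma hasDerivAt_momentum {n : ℕ} {M : (Fin n → ℝ) → Matrix (Fin n) (Fin n) ℝ}
    {C : (Fin n → ℝ) → (Fin n → ℝ) → Matrix (Fin n) (Fin n) ℝ} (h1 : PropP1 M) (h2 : PropP2 M C)
    {q : ℝ → Fin n → ℝ} (hq : ContDiff ℝ 2 q) (t : ℝ) :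
    HasDerivAt (fun s => M (q s) *ᵥ deriv q s)
      (M (q t) *ᵥ deriv (deriv q) t + C (q t) (deriv q t) *ᵥ deriv q t
        + (C (q t) (deriv q t))ᵀ *ᵥ deriv q t) t := by
  have hM : ∀ i j, HasDerivAt (fun s => M (q s) i j) (deriv (fun s => M (q s) i j) t) t := by
    intro i j
    exact ((((h1.1 i j).differentiable one_ne_zero).comp
      (hq.differentiable (by norm_num))) t).hasDerivAt
  have hd := HasDerivAt.mulVec_vec (M := fun s => M (q s))
    (M' := Matrix.of fun i j => deriv (fun s => M (q s) i j) t) hM (hq.hasDerivAt_deriv_vec t)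
  have hskew := h2.2 q (hq.of_le (by norm_num)) t
  have hsum : (Matrix.of fun i j => deriv (fun s => M (q s) i j) t)
      = C (q t) (deriv q t) + (C (q t) (deriv q t))ᵀ := by
    ext i j
    have h := congrFun (congrFun hskew i) j
    have hs : (fun s => M (q s) j i) = fun s => M (q s) i j :=
      funext fun s => (h1.2.1 (q s)).apply i j
    simp only [transpose_apply, Matrix.sub_apply, Matrix.neg_apply, Matrix.smul_apply, of_apply,
      smul_eq_mul, hs, Matrix.add_apply] at h ⊢
    linarith
  rw [hsum, add_mulVec, ← add_assoc] at hd
  exact hd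

/-- Rate of change of (twice) the kinetic energy. -/
lemma hasDerivAt_kinetic {n : ℕ} {M : (Fin n → ℝ) → Matrix (Fin n) (Fin n) ℝ}
    {C : (Fin n → ℝ) → (Fin n → ℝ) → Matrix (Fin n) (Fin n) ℝ} (h1 : PropP1 M) (h2 : PropP2 M C)
    {q : ℝ → Fin n → ℝ} (hq : ContDiff ℝ 2 q) (t : ℝ) :
    HasDerivAt (fun s => deriv q s ⬝ᵥ M (q s) *ᵥ deriv q s)
      (2 * (deriv q t ⬝ᵥ
        (M (q t) *ᵥ deriv (deriv q) t + C (q t) (deriv q t) *ᵥ deriv q t))) t := by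
  have hd := (hq.hasDerivAt_deriv_vec t).dotProduct_vec (hasDerivAt_momentum h1 h2 hq t)
  have e1 := (h1.2.1 (q t)).dotProduct_mulVec_comm (deriv (deriv q) t) (deriv q t)
  have e2 : deriv q t ⬝ᵥ (C (q t) (deriv q t))ᵀ *ᵥ deriv q t
      = deriv q t ⬝ᵥ C (q t) (deriv q t) *ᵥ deriv q t := by
    rw [mulVec_transpose, dotProduct_comm, ← dotProduct_mulVec]
  convert hd using 1
  simp only [dotProduct_add, e1, e2]
  ring

/-- The Krasovskii functional `∫_{t-h}^t (s - t + h) g(s) ds` attached to an antiderivative `F`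
of a nonnegative function `g`. -/
lemma exists_krasovskii {F g : ℝ → ℝ} (hF : ∀ t, HasDerivAt F (g t) t) (hg : ∀ t, 0 ≤ g t)
    {h : ℝ} (hh : 0 < h) :
    ∃ U : ℝ → ℝ, (∀ t, HasDerivAt U (h * g t - (F t - F (t - h))) t) ∧
      ∀ t, 0 ≤ U t ∧ U t ≤ h * (F t - F (t - h)) := by
  have hcont : Continuous F := continuous_iff_continuousAt.2 fun t => (hF t).continuousAt
  have hmono : Monotone F := monotone_of_hasDerivAt_nonneg hF hg
  have hP : ∀ t, HasDerivAt (fun u => ∫ s in (0 : ℝ)..u, F s) (F t) t := fun t =>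
    (hcont.integral_hasStrictDerivAt 0 t).hasDerivAt
  refine ⟨fun t => h * F t - ((∫ s in (0 : ℝ)..t, F s) - ∫ s in (0 : ℝ)..(t - h), F s),
    fun t => ?_, fun t => ?_⟩
  · have h2 : HasDerivAt (fun t => ∫ s in (0 : ℝ)..(t - h), F s) (F (t - h)) t :=
      (hP (t - h)).comp_sub_const t h
    exact ((hF t).const_mul h).sub ((hP t).sub h2)
  · have hi : ∀ a b, IntervalIntegrable F volume a b := hcont.intervalIntegrable
    have hsub : (∫ s in (0 : ℝ)..t, F s) - ∫ s in (0 : ℝ)..(t - h), F s = ∫ s in (t - h)..t, F s :=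
      intervalIntegral.integral_interval_sub_left (hi _ _) (hi _ _)
    have hle : t - h ≤ t := by linarith
    have hup : ∫ s in (t - h)..t, F s ≤ h * F t := by
      calc _ ≤ ∫ _s in (t - h)..t, F t :=
            intervalIntegral.integral_mono_on hle (hi _ _) (by simp) fun s hs => hmono hs.2
        _ = _ := by simp
    have hlo : h * F (t - h) ≤ ∫ s in (t - h)..t, F s := by
      calc _ = ∫ _s in (t - h)..t, F (t - h) := by simp
        _ ≤ _ := intervalIntegral.integral_mono_on hle (by simp) (hi _ _) fun s hs => hmono hs.1
    dsimp only
    rw [hsub]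
    constructor <;> linarith

/-- Jensen's inequality for the displacement over a delay `d ≤ h`. -/
lemma jensen_displacement {n : ℕ} {R : Matrix (Fin n) (Fin n) ℝ} (hR : R.PosDef)
    {q : ℝ → Fin n → ℝ} (hq : ContDiff ℝ 2 q) {F : ℝ → ℝ}
    (hF : ∀ t, HasDerivAt F (deriv q t ⬝ᵥ R *ᵥ deriv q t) t) {h d : ℝ} (hh : 0 < h)
    (hd0 : 0 ≤ d) (hd : d ≤ h) (t : ℝ) :
    h⁻¹ * ((q t - q (t - d)) ⬝ᵥ R *ᵥ (q t - q (t - d))) ≤ F t - F (t - h) := by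
  have hnn : ∀ x : Fin n → ℝ, 0 ≤ x ⬝ᵥ R *ᵥ x := fun x => by
    simpa using hR.posSemidef.dotProduct_mulVec_nonneg x
  have hFm : Monotone F := monotone_of_hasDerivAt_nonneg hF fun s => hnn _
  set w := q t - q (t - d) with hw
  set c := h⁻¹ • w with hc
  have hφ : ∀ s, HasDerivAt (fun s => F s - 2 * (c ⬝ᵥ R *ᵥ q s) + s * (c ⬝ᵥ R *ᵥ c))
      ((deriv q s - c) ⬝ᵥ R *ᵥ (deriv q s - c)) s := by
    intro s
    have hlin := (hasDerivAt_const s c).dotProduct_vec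
      (HasDerivAt.const_mulVec R (hq.hasDerivAt_vec s))
    have h := ((hF s).sub (hlin.const_mul 2)).add ((hasDerivAt_id s).mul_const (c ⬝ᵥ R *ᵥ c))
    refine h.congr_deriv ?_
    simp only [mulVec_sub, dotProduct_sub, sub_dotProduct, zero_dotProduct,
      hR.isSymm_real.dotProduct_mulVec_comm (deriv q s) c]
    ring
  have hm := monotone_of_hasDerivAt_nonneg hφ (fun s => hnn _) (show t - d ≤ t by linarith)
  have hF2 : F (t - h) ≤ F (t - d) := hFm (by linarith)
  have e1 : c ⬝ᵥ R *ᵥ q t - c ⬝ᵥ R *ᵥ q (t - d) = h⁻¹ * (w ⬝ᵥ R *ᵥ w) := by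
    rw [← dotProduct_sub, ← mulVec_sub, ← hw, hc, smul_dotProduct, smul_eq_mul]
  have e2 : c ⬝ᵥ R *ᵥ c = h⁻¹ * (h⁻¹ * (w ⬝ᵥ R *ᵥ w)) := by
    rw [hc, smul_dotProduct, mulVec_smul, dotProduct_smul, smul_eq_mul, smul_eq_mul]
  have e3 : d * (c ⬝ᵥ R *ᵥ c) ≤ h⁻¹ * (w ⬝ᵥ R *ᵥ w) := by
    have : d * (c ⬝ᵥ R *ᵥ c) ≤ h * (c ⬝ᵥ R *ᵥ c) := mul_le_mul_of_nonneg_right hd (hnn c)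
    rwa [e2, mul_inv_cancel_left₀ hh.ne', ← e2] at this
  dsimp only at hm
  linarith

/-- The direction field `e / √(1 + |e|²)` is differentiable with derivative bounded by `ė`. -/
lemma exists_hasDerivAt_saturation {n : ℕ} {e : ℝ → Fin n → ℝ} {e' : Fin n → ℝ} {t : ℝ}
    (he : HasDerivAt e e' t) :
    ∃ y', HasDerivAt (fun s => (√(1 + e s ⬝ᵥ e s))⁻¹ • e s) y' t ∧ y' ⬝ᵥ y' ≤ e' ⬝ᵥ e' := by
  have hpos : 0 < 1 + e t ⬝ᵥ e t := by linarith [dotProduct_self_nonneg_real (e t)]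
  have hr := ((he.dotProduct_vec he).const_add 1).sqrt hpos.ne'
  have hr0 : 0 < √(1 + e t ⬝ᵥ e t) := Real.sqrt_pos.2 hpos
  refine ⟨_, (hr.inv hr0.ne').smul he, ?_⟩
  have hsq : √(1 + e t ⬝ᵥ e t) ^ 2 = 1 + e t ⬝ᵥ e t := Real.sq_sqrt hpos.le
  have hee := dotProduct_self_nonneg_real (e t)
  set r := √(1 + e t ⬝ᵥ e t) with hrdef
  have hr1 : 1 ≤ r := by nlinarith
  simp only [dotProduct_add, add_dotProduct, dotProduct_smul, smul_dotProduct, smul_eq_mul,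
    Pi.inv_apply, dotProduct_comm e' (e t), ← hrdef]
  set p := e t ⬝ᵥ e'
  set u := e' ⬝ᵥ e'
  have hu : 0 ≤ u := dotProduct_self_nonneg_real e'
  have hx : e t ⬝ᵥ e t = r ^ 2 - 1 := by linarith
  rw [hx]
  have hid : r⁻¹ * (r⁻¹ * u) + r⁻¹ * (-((p + p) / (2 * r)) / r ^ 2 * p)
      + (-((p + p) / (2 * r)) / r ^ 2 * (r⁻¹ * p)
        + -((p + p) / (2 * r)) / r ^ 2 * (-((p + p) / (2 * r)) / r ^ 2 * (r ^ 2 - 1)))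
      = u / r ^ 2 - p ^ 2 / r ^ 4 - p ^ 2 / r ^ 6 := by
    field_simp; ring
  have h1 : u / r ^ 2 ≤ u := div_le_self hu (by nlinarith)
  have h2 : 0 ≤ p ^ 2 / r ^ 4 := by positivity
  have h3 : 0 ≤ p ^ 2 / r ^ 6 := by positivity
  linarith

/-- The Round-Robin LMI as a coercivity estimate. -/
lemma exists_lmi_coercive {n : ℕ} {hM hS : ℝ} {Kp Kd Rm Rs : Matrix (Fin n) (Fin n) ℝ}
    (hKp : Kp.IsSymm) (hLMI : (-(PiRR hM hS Kp Kd Rm Rs)).PosDef) :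
    ∃ ε > 0, ∀ a b z w : Fin n → ℝ,
      ε * (a ⬝ᵥ a + b ⬝ᵥ b + z ⬝ᵥ z + w ⬝ᵥ w) ≤
        2 * (a ⬝ᵥ Kd *ᵥ a) + 2 * (b ⬝ᵥ Kd *ᵥ b) + 2 * (a ⬝ᵥ Kp *ᵥ w) + 2 * (b ⬝ᵥ Kp *ᵥ z)
          - hM * (a ⬝ᵥ Rm *ᵥ a) - hS * (b ⬝ᵥ Rs *ᵥ b)
          + hM⁻¹ * (z ⬝ᵥ Rm *ᵥ z) + hS⁻¹ * (w ⬝ᵥ Rs *ᵥ w) := by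
  obtain ⟨ε, hε, h⟩ := hLMI.exists_coercive
  refine ⟨ε, hε, fun a b z w => ?_⟩
  have hx := h fun p => ![a, b, z, w] p.1 p.2
  have e1 : (fun p : Fin 4 × Fin n => ![a, b, z, w] p.1 p.2) ⬝ᵥ
      (fun p : Fin 4 × Fin n => ![a, b, z, w] p.1 p.2)
      = a ⬝ᵥ a + b ⬝ᵥ b + z ⬝ᵥ z + w ⬝ᵥ w := by
    simp [dotProduct, Fintype.sum_prod_type, Fin.sum_univ_four]
  have e2 : ∀ i : Fin 4, ∀ j : Fin n,
      ((-(PiRR hM hS Kp Kd Rm Rs)) *ᵥ fun p : Fin 4 × Fin n => ![a, b, z, w] p.1 p.2) (i, j)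
      = ![(2 : ℝ) • Kd *ᵥ a - hM • Rm *ᵥ a + Kp *ᵥ w, (2 : ℝ) • Kd *ᵥ b - hS • Rs *ᵥ b + Kp *ᵥ z,
          Kp *ᵥ b + hM⁻¹ • Rm *ᵥ z, Kp *ᵥ a + hS⁻¹ • Rs *ᵥ w] i j := by
    intro i j
    simp only [mulVec, dotProduct, Fintype.sum_prod_type, Fin.sum_univ_four]
    fin_cases i
    · change ∑ k, -((-2 : ℝ) * Kd j k + hM * Rm j k) * a k + ∑ k, -(0 : ℝ) * b k
        + ∑ k, -(0 : ℝ) * z k + ∑ k, -(-Kp j k) * w k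
        = 2 * ∑ k, Kd j k * a k - hM * ∑ k, Rm j k * a k + ∑ k, Kp j k * w k
      simp only [Finset.mul_sum, ← Finset.sum_add_distrib, ← Finset.sum_sub_distrib]
      exact Finset.sum_congr rfl fun k _ => by ring
    · change ∑ k, -(0 : ℝ) * a k + ∑ k, -((-2 : ℝ) * Kd j k + hS * Rs j k) * b k
        + ∑ k, -(-Kp j k) * z k + ∑ k, -(0 : ℝ) * w k
        = 2 * ∑ k, Kd j k * b k - hS * ∑ k, Rs j k * b k + ∑ k, Kp j k * z k
      simp only [Finset.mul_sum, ← Finset.sum_add_distrib, ← Finset.sum_sub_distrib]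
      exact Finset.sum_congr rfl fun k _ => by ring
    · change ∑ k, -(0 : ℝ) * a k + ∑ k, -(-Kp j k) * b k
        + ∑ k, -(-hM⁻¹ * Rm j k) * z k + ∑ k, -(0 : ℝ) * w k
        = ∑ k, Kp j k * b k + hM⁻¹ * ∑ k, Rm j k * z k
      simp only [Finset.mul_sum, ← Finset.sum_add_distrib]
      exact Finset.sum_congr rfl fun k _ => by ring
    · change ∑ k, -(-Kp j k) * a k + ∑ k, -(0 : ℝ) * b k
        + ∑ k, -(0 : ℝ) * z k + ∑ k, -(-hS⁻¹ * Rs j k) * w k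
        = ∑ k, Kp j k * a k + hS⁻¹ * ∑ k, Rs j k * w k
      simp only [Finset.mul_sum, ← Finset.sum_add_distrib]
      exact Finset.sum_congr rfl fun k _ => by ring
  have e3 : (fun p : Fin 4 × Fin n => ![a, b, z, w] p.1 p.2) ⬝ᵥ (-(PiRR hM hS Kp Kd Rm Rs)) *ᵥ
      (fun p : Fin 4 × Fin n => ![a, b, z, w] p.1 p.2)
      = a ⬝ᵥ ((2 : ℝ) • Kd *ᵥ a - hM • Rm *ᵥ a + Kp *ᵥ w)
        + b ⬝ᵥ ((2 : ℝ) • Kd *ᵥ b - hS • Rs *ᵥ b + Kp *ᵥ z)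
        + z ⬝ᵥ (Kp *ᵥ b + hM⁻¹ • Rm *ᵥ z) + w ⬝ᵥ (Kp *ᵥ a + hS⁻¹ • Rs *ᵥ w) := by
    conv_lhs => rw [dotProduct]
    rw [Fintype.sum_prod_type, Fin.sum_univ_four]
    simp only [e2]
    rfl
  rw [e1, e3] at hx
  simp only [dotProduct_add, dotProduct_sub, dotProduct_smul, smul_eq_mul,
    hKp.dotProduct_mulVec_comm z b, hKp.dotProduct_mulVec_comm w a] at hx
  linarith

/-- The saturated cross term `-(e / √(1 + |e|²)) · M(q) q̇`, whose derivative dissipates the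
synchronization error `e` up to terms quadratic in velocities and displacements. -/
lemma exists_cross_term {n : ℕ} {t₀ Δ : ℝ} {M : (Fin n → ℝ) → Matrix (Fin n) (Fin n) ℝ}
    {C : (Fin n → ℝ) → (Fin n → ℝ) → Matrix (Fin n) (Fin n) ℝ}
    (hP1 : PropP1 M) (hP2 : PropP2 M C) (hP3 : PropP3 C)
    {lM : ℝ} (hlM : ∀ q x, 0 ≤ x ⬝ᵥ M q *ᵥ x ∧ x ⬝ᵥ M q *ᵥ x ≤ lM * (x ⬝ᵥ x)) (hlM0 : 0 < lM)
    {dm : ℝ → ℝ} {Kp Kd : Matrix (Fin n) (Fin n) ℝ} (hKp : Kp.PosDef) (hKd : Kd.PosDef)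
    (γ : Fin n → ℝ) {qm qs : ℝ → Fin n → ℝ} (hqm : ContDiff ℝ 2 qm) (hqs : ContDiff ℝ 2 qs)
    {fs : ℝ → Fin n → ℝ}
    (hdyn : ∀ t ≥ t₀, fs t = M (qs t) *ᵥ deriv (deriv qs) t
      + C (qs t) (deriv qs t) *ᵥ deriv qs t + Kd *ᵥ deriv qs t
      + Kp *ᵥ ((qs t - γ) - qm (t - dm t)))
    (hf : ∀ t ≥ t₀, ‖fs t‖ ≤ Δ) :
    ∃ (X X' : ℝ → ℝ) (k K : ℝ), 0 < k ∧ 0 < K ∧ (∀ t, HasDerivAt X (X' t) t) ∧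
      (∀ t, |X t| ≤ lM / 2 * (1 + deriv qs t ⬝ᵥ deriv qs t)) ∧
      ∀ t ≥ t₀, X' t ≤ -k * (√(1 + (qm t - qs t + γ) ⬝ᵥ (qm t - qs t + γ)) - 1)
        + K * (1 + deriv qm t ⬝ᵥ deriv qm t + deriv qs t ⬝ᵥ deriv qs t
          + (qm t - qm (t - dm t)) ⬝ᵥ (qm t - qm (t - dm t))) := by
  obtain ⟨c, hc, hC⟩ := hP3
  obtain ⟨k, hk, hKpl⟩ := hKp.exists_coercive
  obtain ⟨kp, hkp, hKpu⟩ := Kp.exists_quadratic_bound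
  obtain ⟨kd, hkd, hKdu⟩ := Kd.exists_quadratic_bound
  have hnnp : ∀ x : Fin n → ℝ, 0 ≤ x ⬝ᵥ Kp *ᵥ x := fun x => by
    simpa using hKp.posSemidef.dotProduct_mulVec_nonneg x
  have hnnd : ∀ x : Fin n → ℝ, 0 ≤ x ⬝ᵥ Kd *ᵥ x := fun x => by
    simpa using hKd.posSemidef.dotProduct_mulVec_nonneg x
  have he : ∀ t, HasDerivAt (fun s => qm s - qs s + γ) (deriv qm t - deriv qs t) t := fun t =>
    ((hqm.hasDerivAt_vec t).sub (hqs.hasDerivAt_vec t)).add_const γ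
  choose y' hy' hy'le using fun t => exists_hasDerivAt_saturation (he t)
  set e : ℝ → Fin n → ℝ := fun s => qm s - qs s + γ with hedef
  set r : ℝ → ℝ := fun s => √(1 + e s ⬝ᵥ e s) with hrdef
  set y : ℝ → Fin n → ℝ := fun s => (r s)⁻¹ • e s with hydef
  set p : ℝ → Fin n → ℝ := fun s => M (qs s) *ᵥ deriv qs s with hpdef
  have hp := hasDerivAt_momentum hP1 hP2 hqs
  have hrsq : ∀ t, r t ^ 2 = 1 + e t ⬝ᵥ e t := fun t =>
    Real.sq_sqrt (by linarith [dotProduct_self_nonneg_real (e t)])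
  have hr1 : ∀ t, 1 ≤ r t := fun t => by
    rw [hrdef]
    exact Real.one_le_sqrt.2 (by linarith [dotProduct_self_nonneg_real (e t)])
  have hyy : ∀ t, y t ⬝ᵥ y t ≤ 1 := fun t => by
    have h0 : 0 < r t := one_pos.trans_le (hr1 t)
    simp only [hydef, smul_dotProduct, dotProduct_smul, smul_eq_mul]
    rw [← mul_assoc, ← mul_inv, ← sq, inv_mul_le_iff₀ (by positivity), hrsq]
    linarith
  have hyn : ∀ t, ‖y t‖ ≤ 1 := fun t => by
    have := (norm_sq_le_dotProduct (y t)).trans (hyy t)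
    exact (sq_le_one_iff₀ (norm_nonneg _)).1 this
  refine ⟨fun t => -(y t ⬝ᵥ p t), _, k,
    3 * lM / 2 + (1 + n * Δ ^ 2) / 2 + kd / 2 + kp / 2 + n * c, hk, by positivity,
    fun t => ((hy' t).dotProduct_vec (hp t)).neg, fun t => ?_, fun t ht => ?_⟩
  · rw [abs_neg]
    refine (abs_dotProduct_mulVec_le (hP1.2.1 _) (fun x => (hlM _ x).1)
      (fun x => (hlM _ x).2) _ _).trans ?_
    gcongr
    exact hyy t
  · have hτ : M (qs t) *ᵥ deriv (deriv qs) t + C (qs t) (deriv qs t) *ᵥ deriv qs t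
        = fs t - Kd *ᵥ deriv qs t - Kp *ᵥ (qm t - qm (t - dm t)) + Kp *ᵥ e t := by
      rw [hdyn t ht, hedef]
      simp only [mulVec_sub, mulVec_add]
      abel
    rw [hτ]
    set a := deriv qm t
    set b := deriv qs t
    set z := qm t - qm (t - dm t)
    have i1 := abs_le.1 (abs_dotProduct_mulVec_le (hP1.2.1 (qs t)) (fun x => (hlM _ x).1)
      (fun x => (hlM _ x).2) (y' t) b)
    have i2 := abs_le.1 (abs_dotProduct_mulVec_le hKd.isSymm_real hnnd hKdu (y t) b)
    have i3 := abs_le.1 (abs_dotProduct_mulVec_le hKp.isSymm_real hnnp hKpu (y t) z)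
    have i4 := two_mul_dotProduct_le one_pos (y t) (-fs t)
    have i5 : fs t ⬝ᵥ fs t ≤ n * Δ ^ 2 := dotProduct_self_le_of_norm_le (hf t ht)
    have i6 : k * (r t - 1) ≤ y t ⬝ᵥ Kp *ᵥ e t := by
      have h0 : 0 < r t := one_pos.trans_le (hr1 t)
      rw [hydef, smul_dotProduct, smul_eq_mul, le_inv_mul_iff₀ h0]
      refine le_trans ?_ (hKpl (e t))
      have h2 : e t ⬝ᵥ e t = r t ^ 2 - 1 := by linarith [hrsq t]
      rw [h2]
      nlinarith [hr1 t]
    have i7 : |y t ⬝ᵥ (C (qs t) b)ᵀ *ᵥ b| ≤ n * c * (b ⬝ᵥ b) := by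
      rw [mulVec_transpose, dotProduct_comm, ← dotProduct_mulVec]
      refine (abs_dotProduct_le_norm _ _).trans ?_
      rw [mul_assoc]
      refine mul_le_mul_of_nonneg_left ?_ (Nat.cast_nonneg n)
      have h1 := hC (qs t) b (y t)
      have h2 : c * ‖b‖ * ‖y t‖ ≤ c * ‖b‖ := mul_le_of_le_one_right (by positivity) (hyn t)
      calc ‖b‖ * ‖C (qs t) b *ᵥ y t‖ ≤ ‖b‖ * (c * ‖b‖) := by gcongr; exact h1.trans h2
        _ = c * ‖b‖ ^ 2 := by ring
        _ ≤ c * (b ⬝ᵥ b) := by gcongr; exact norm_sq_le_dotProduct b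
    have i8 : (a - b) ⬝ᵥ (a - b) ≤ 2 * (a ⬝ᵥ a) + 2 * (b ⬝ᵥ b) := by
      have := dotProduct_self_nonneg_real (a + b)
      simp only [dotProduct_add, dotProduct_sub, add_dotProduct, sub_dotProduct] at this ⊢
      linarith
    have i7' := abs_le.1 i7
    have i9 : y' t ⬝ᵥ y' t ≤ (a - b) ⬝ᵥ (a - b) := hy'le t
    have ha := dotProduct_self_nonneg_real a
    have hb := dotProduct_self_nonneg_real b
    have hz := dotProduct_self_nonneg_real z
    simp only [dotProduct_neg, neg_dotProduct, neg_neg, inv_one, one_mul] at i4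
    have hy2 := hyy t
    rw [neg_add, ← sub_eq_add_neg]
    have hexp : y t ⬝ᵥ (fs t - Kd *ᵥ b - Kp *ᵥ z + Kp *ᵥ e t + (C (qs t) b)ᵀ *ᵥ b)
        = y t ⬝ᵥ fs t - y t ⬝ᵥ Kd *ᵥ b - y t ⬝ᵥ Kp *ᵥ z + y t ⬝ᵥ Kp *ᵥ e t
          + y t ⬝ᵥ (C (qs t) b)ᵀ *ᵥ b := by
      simp only [dotProduct_add, dotProduct_sub]
    change -(y' t ⬝ᵥ M (qs t) *ᵥ b) -
      y t ⬝ᵥ (fs t - Kd *ᵥ b - Kp *ᵥ z + Kp *ᵥ e t + (C (qs t) b)ᵀ *ᵥ b) ≤ -k * (r t - 1) + _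
    rw [hexp]
    have j1 : lM / 2 * (y' t ⬝ᵥ y' t + b ⬝ᵥ b)
        ≤ lM / 2 * (2 * (a ⬝ᵥ a) + 2 * (b ⬝ᵥ b) + b ⬝ᵥ b) := by gcongr; linarith
    have j2 : kd / 2 * (y t ⬝ᵥ y t + b ⬝ᵥ b) ≤ kd / 2 * (1 + b ⬝ᵥ b) := by gcongr
    have j3 : kp / 2 * (y t ⬝ᵥ y t + z ⬝ᵥ z) ≤ kp / 2 * (1 + z ⬝ᵥ z) := by gcongr
    have hS : ∀ u v : ℝ, 0 ≤ u → 0 ≤ v → 0 ≤ u * v := fun _ _ => mul_nonneg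
    have hn : (0 : ℝ) ≤ n * c := by positivity
    have hD : (0 : ℝ) ≤ 1 + n * Δ ^ 2 := by positivity
    nlinarith [hS _ _ hlM0.le ha, hS _ _ hlM0.le hb, hS _ _ hlM0.le hz, hS _ _ hkd.le ha,
      hS _ _ hkd.le hb, hS _ _ hkd.le hz, hS _ _ hkp.le ha, hS _ _ hkp.le hb, hS _ _ hkp.le hz,
      hS _ _ hn ha, hS _ _ hn hb, hS _ _ hn hz, hS _ _ hD ha, hS _ _ hD hb, hS _ _ hD hz, hyy t]

set_option maxHeartbeats 800000 in
/-- Lyapunov–Krasovskii functional of a single master–slave pair: its derivative, together with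
the power of the pair's control on the master, is dissipative outside a bounded set. -/
lemma exists_pair_functional {n : ℕ} {t₀ Δ hM hS : ℝ}
    {Mm Ms : (Fin n → ℝ) → Matrix (Fin n) (Fin n) ℝ}
    {Cs : (Fin n → ℝ) → (Fin n → ℝ) → Matrix (Fin n) (Fin n) ℝ}
    (hP1m : PropP1 Mm) (hP1 : PropP1 Ms) (hP2 : PropP2 Ms Cs) (hP3 : PropP3 Cs)
    (hhM : 0 < hM) (hhS : 0 < hS) {dm ds : ℝ → ℝ}
    (hdm : ∀ t ≥ t₀, 0 ≤ dm t ∧ dm t ≤ hM) (hds : ∀ t ≥ t₀, 0 ≤ ds t ∧ ds t ≤ hS)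
    {Kp Kd Rm Rs : Matrix (Fin n) (Fin n) ℝ} (hKp : Kp.PosDef) (hKd : Kd.PosDef)
    (γ : Fin n → ℝ) {qm qs : ℝ → Fin n → ℝ} (hqm : ContDiff ℝ 2 qm) (hqs : ContDiff ℝ 2 qs)
    {fm fs : ℝ → Fin n → ℝ}
    (hdyn : ∀ t ≥ t₀, fs t = Ms (qs t) *ᵥ deriv (deriv qs) t
      + Cs (qs t) (deriv qs t) *ᵥ deriv qs t + Kd *ᵥ deriv qs t
      + Kp *ᵥ ((qs t - γ) - qm (t - dm t)))
    (hRm : Rm.PosDef) (hRs : Rs.PosDef) (hLMI : (-(PiRR hM hS Kp Kd Rm Rs)).PosDef)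
    (hfm : ∀ t ≥ t₀, ‖fm t‖ ≤ Δ) (hfs : ∀ t ≥ t₀, ‖fs t‖ ≤ Δ) :
    ∃ (Z D Φ : ℝ → ℝ) (A C c : ℝ), 0 < c ∧ (∀ t, HasDerivAt Z (D t) t) ∧ ∀ t ≥ t₀, 0 ≤ Φ t ∧
      D t + 2 * (deriv qm t ⬝ᵥ (fm t - (Kp *ᵥ (qm t - qs (t - ds t)) + Kd *ᵥ deriv qm t)))
        ≤ C - Φ t ∧
      deriv qm t ⬝ᵥ Mm (qm t) *ᵥ deriv qm t + Z t ≤ A * (1 + Φ t) ^ 2 ∧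
      c * (deriv qs t ⬝ᵥ deriv qs t) ≤ Z t + A := by
  obtain ⟨_, LM, _, hLM, hMm⟩ := hP1m.exists_bounds
  obtain ⟨lm, lM, hlm, hlM, hMs⟩ := hP1.exists_bounds
  have hMs' : ∀ q x, 0 ≤ x ⬝ᵥ Ms q *ᵥ x ∧ x ⬝ᵥ Ms q *ᵥ x ≤ lM * (x ⬝ᵥ x) := fun q x =>
    ⟨(mul_nonneg hlm.le (dotProduct_self_nonneg_real x)).trans (hMs q x).1, (hMs q x).2⟩
  obtain ⟨X, X', k, K, hk, hK, hX, hXb, hX'⟩ :=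
    exists_cross_term hP1 hP2 hP3 hMs' hlM hKp hKd γ hqm hqs hdyn hfs
  obtain ⟨ε, hε, hcoer⟩ := exists_lmi_coercive hKp.isSymm_real hLMI
  obtain ⟨kp, hkp, hKpu⟩ := Kp.exists_quadratic_bound
  obtain ⟨km, hkm, hRmu⟩ := Rm.exists_quadratic_bound
  obtain ⟨ks, hks, hRsu⟩ := Rs.exists_quadratic_bound
  have hnn : ∀ {R : Matrix (Fin n) (Fin n) ℝ}, R.PosDef → ∀ x : Fin n → ℝ, 0 ≤ x ⬝ᵥ R *ᵥ x :=
    fun hR x => by simpa using hR.posSemidef.dotProduct_mulVec_nonneg x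
  have hcont : ∀ {q : ℝ → Fin n → ℝ}, ContDiff ℝ 2 q → ∀ R : Matrix (Fin n) (Fin n) ℝ,
      ∃ F : ℝ → ℝ, ∀ t, HasDerivAt F (deriv q t ⬝ᵥ R *ᵥ deriv q t) t := by
    intro q hq R
    have hc : Continuous fun t => deriv q t ⬝ᵥ R *ᵥ deriv q t := continuous_iff_continuousAt.2
      fun t => ((hq.hasDerivAt_deriv_vec t).dotProduct_vec
        (HasDerivAt.const_mulVec R (hq.hasDerivAt_deriv_vec t))).continuousAt
    exact ⟨_, fun t => (hc.integral_hasStrictDerivAt 0 t).hasDerivAt⟩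
  obtain ⟨Fm, hFm⟩ := hcont hqm Rm
  obtain ⟨Fs, hFs⟩ := hcont hqs Rs
  obtain ⟨Um, hUm, hUmb⟩ := exists_krasovskii hFm (fun t => hnn hRm _) hhM
  obtain ⟨Us, hUs, hUsb⟩ := exists_krasovskii hFs (fun t => hnn hRs _) hhS
  set η := ε / (4 * (hM * km + hS * ks)) with hη
  set δ := min (ε / (4 * K)) (lm / lM) with hδ
  have hη0 : 0 < η := by positivity
  have hδ0 : 0 < δ := lt_min (by positivity) (by positivity)
  have hηM : η * (hM * km) + η * (hS * ks) = ε / 4 := by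
    rw [hη, ← mul_add]; field_simp
  have hδK : δ * K ≤ ε / 4 := by
    calc δ * K ≤ ε / (4 * K) * K := by gcongr; exact min_le_left _ _
      _ = ε / 4 := by field_simp
  have hδl : δ * lM ≤ lm := by
    calc δ * lM ≤ lm / lM * lM := by gcongr; exact min_le_right _ _
      _ = lm := by field_simp
  set e : ℝ → Fin n → ℝ := fun s => qm s - qs s + γ with hedef
  have he : ∀ t, HasDerivAt e (deriv qm t - deriv qs t) t := fun t =>
    ((hqm.hasDerivAt_vec t).sub (hqs.hasDerivAt_vec t)).add_const γ
  set r : ℝ → ℝ := fun s => √(1 + e s ⬝ᵥ e s) with hrdef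
  have hrsq : ∀ t, r t ^ 2 = 1 + e t ⬝ᵥ e t := fun t =>
    Real.sq_sqrt (by linarith [dotProduct_self_nonneg_real (e t)])
  have hr0 : ∀ t, 0 ≤ r t := fun t => Real.sqrt_nonneg _
  have hpot : ∀ t, HasDerivAt (fun s => e s ⬝ᵥ Kp *ᵥ e s)
      (2 * ((deriv qm t - deriv qs t) ⬝ᵥ Kp *ᵥ e t)) t := fun t => by
    refine ((he t).dotProduct_vec (HasDerivAt.const_mulVec Kp (he t))).congr_deriv ?_
    rw [hKp.isSymm_real.dotProduct_mulVec_comm (e t)]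
    ring
  set gm : ℝ → ℝ := fun t => Fm t - Fm (t - hM) with hgm
  set gs : ℝ → ℝ := fun t => Fs t - Fs (t - hS) with hgs
  have hgm0 : ∀ t, 0 ≤ gm t := fun t =>
    nonneg_of_mul_nonneg_right ((hUmb t).1.trans (hUmb t).2) hhM
  have hgs0 : ∀ t, 0 ≤ gs t := fun t =>
    nonneg_of_mul_nonneg_right ((hUsb t).1.trans (hUsb t).2) hhS
  set Φ : ℝ → ℝ := fun t => ε / 4 * (deriv qm t ⬝ᵥ deriv qm t + deriv qs t ⬝ᵥ deriv qs t)
    + η * (gm t + gs t) + δ * k * r t with hΦ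
  refine ⟨fun t => deriv qs t ⬝ᵥ Ms (qs t) *ᵥ deriv qs t + e t ⬝ᵥ Kp *ᵥ e t
      + (1 + η) * (Um t + Us t) + δ * X t, _, Φ,
    (LM + lM) * (4 / ε) + kp * (1 / (δ * k) ^ 2) + (1 + η) * ((hM + hS) / η)
      + δ * (lM / 2 * (1 + 4 / ε)) + lm,
    δ * k + ε / 4 + (ε / 4)⁻¹ * (n * (Δ + ‖Kp *ᵥ γ‖) ^ 2 + n * Δ ^ 2), lm / 2, by positivity,
    fun t => (((hasDerivAt_kinetic hP1 hP2 hqs t).add (hpot t)).add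
      (((hUm t).add (hUs t)).const_mul (1 + η))).add ((hX t).const_mul δ), fun t ht => ?_⟩
  have ha := dotProduct_self_nonneg_real (deriv qm t)
  have hb := dotProduct_self_nonneg_real (deriv qs t)
  have hΦab : ε / 4 * (deriv qm t ⬝ᵥ deriv qm t + deriv qs t ⬝ᵥ deriv qs t) ≤ Φ t := by
    have h1 : 0 ≤ η * (gm t + gs t) := mul_nonneg hη0.le (add_nonneg (hgm0 t) (hgs0 t))
    have h2 : 0 ≤ δ * k * r t := mul_nonneg (by positivity) (hr0 t)
    simp only [hΦ]; linarith
  have hΦg : η * (gm t + gs t) ≤ Φ t := by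
    have h1 : 0 ≤ ε / 4 * (deriv qm t ⬝ᵥ deriv qm t + deriv qs t ⬝ᵥ deriv qs t) := by positivity
    have h2 : 0 ≤ δ * k * r t := mul_nonneg (by positivity) (hr0 t)
    simp only [hΦ]; linarith
  have hΦr : δ * k * r t ≤ Φ t := by
    have h1 : 0 ≤ ε / 4 * (deriv qm t ⬝ᵥ deriv qm t + deriv qs t ⬝ᵥ deriv qs t) := by positivity
    have h2 : 0 ≤ η * (gm t + gs t) := mul_nonneg hη0.le (add_nonneg (hgm0 t) (hgs0 t))
    simp only [hΦ]; linarith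
  have hΦ0 : 0 ≤ Φ t := le_trans (by positivity) hΦab
  have hXt := abs_le.1 (hXb t)
  refine ⟨hΦ0, ?_, ?_, ?_⟩
  · have hτ : Ms (qs t) *ᵥ deriv (deriv qs) t + Cs (qs t) (deriv qs t) *ᵥ deriv qs t
        = fs t - Kd *ᵥ deriv qs t - Kp *ᵥ (qm t - qm (t - dm t)) + Kp *ᵥ e t := by
      rw [hdyn t ht, hedef]
      simp only [mulVec_sub, mulVec_add]
      abel
    have hu : fm t - (Kp *ᵥ (qm t - qs (t - ds t)) + Kd *ᵥ deriv qm t)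
        = (fm t + Kp *ᵥ γ) - Kp *ᵥ e t - Kp *ᵥ (qs t - qs (t - ds t)) - Kd *ᵥ deriv qm t := by
      rw [hedef]
      simp only [mulVec_sub, mulVec_add]
      abel
    have jm : hM⁻¹ * ((qm t - qm (t - dm t)) ⬝ᵥ Rm *ᵥ (qm t - qm (t - dm t))) ≤ gm t :=
      jensen_displacement hRm hqm hFm hhM (hdm t ht).1 (hdm t ht).2 t
    have js : hS⁻¹ * ((qs t - qs (t - ds t)) ⬝ᵥ Rs *ᵥ (qs t - qs (t - ds t))) ≤ gs t :=
      jensen_displacement hRs hqs hFs hhS (hds t ht).1 (hds t ht).2 t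
    have hc := hcoer (deriv qm t) (deriv qs t) (qm t - qm (t - dm t)) (qs t - qs (t - ds t))
    have hx : δ * X' t ≤ δ * (-k * (r t - 1) + K * (1 + deriv qm t ⬝ᵥ deriv qm t
        + deriv qs t ⬝ᵥ deriv qs t + (qm t - qm (t - dm t)) ⬝ᵥ (qm t - qm (t - dm t)))) :=
      mul_le_mul_of_nonneg_left (hX' t ht) hδ0.le
    rw [hτ, hu]
    have f1 := two_mul_dotProduct_le (show 0 < ε / 4 by positivity) (deriv qm t) (fm t + Kp *ᵥ γ)
    have f2 := two_mul_dotProduct_le (show 0 < ε / 4 by positivity) (deriv qs t) (fs t)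
    have g1 : (ε / 4)⁻¹ * ((fm t + Kp *ᵥ γ) ⬝ᵥ (fm t + Kp *ᵥ γ))
        ≤ (ε / 4)⁻¹ * (n * (Δ + ‖Kp *ᵥ γ‖) ^ 2) := by
      gcongr
      exact dotProduct_self_le_of_norm_le ((norm_add_le _ _).trans (by gcongr; exact hfm t ht))
    have g2 : (ε / 4)⁻¹ * (fs t ⬝ᵥ fs t) ≤ (ε / 4)⁻¹ * (n * Δ ^ 2) := by
      gcongr
      exact dotProduct_self_le_of_norm_le (hfs t ht)
    have hz := dotProduct_self_nonneg_real (qm t - qm (t - dm t))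
    have hw := dotProduct_self_nonneg_real (qs t - qs (t - ds t))
    have m1 : η * (hM * (deriv qm t ⬝ᵥ Rm *ᵥ deriv qm t))
        ≤ η * (hM * km) * (deriv qm t ⬝ᵥ deriv qm t) := by
      rw [mul_assoc η, mul_assoc hM]; gcongr; exact hRmu _
    have m2 : η * (hS * (deriv qs t ⬝ᵥ Rs *ᵥ deriv qs t))
        ≤ η * (hS * ks) * (deriv qs t ⬝ᵥ deriv qs t) := by
      rw [mul_assoc η, mul_assoc hS]; gcongr; exact hRsu _
    have m3 : η * (hM * km) * (deriv qm t ⬝ᵥ deriv qm t) ≤ ε / 4 * (deriv qm t ⬝ᵥ deriv qm t) := by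
      gcongr
      have : 0 < η * (hS * ks) := by positivity
      linarith
    have m4 : η * (hS * ks) * (deriv qs t ⬝ᵥ deriv qs t) ≤ ε / 4 * (deriv qs t ⬝ᵥ deriv qs t) := by
      gcongr
      have : 0 < η * (hM * km) := by positivity
      linarith
    have m5 := mul_le_mul_of_nonneg_right hδK
      (show 0 ≤ 1 + deriv qm t ⬝ᵥ deriv qm t + deriv qs t ⬝ᵥ deriv qs t
          + (qm t - qm (t - dm t)) ⬝ᵥ (qm t - qm (t - dm t)) by linarith)
    have m6 := mul_nonneg hε.le hz
    have m7 := mul_nonneg hε.le hw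
    have hΦt : Φ t = ε / 4 * (deriv qm t ⬝ᵥ deriv qm t + deriv qs t ⬝ᵥ deriv qs t)
        + η * (gm t + gs t) + δ * k * r t := rfl
    change 2 * _ + 2 * _ + (1 + η) * ((hM * _ - gm t) + (hS * _ - gs t)) + δ * X' t + _ ≤ _
    generalize qm t - qm (t - dm t) = z at *
    generalize qs t - qs (t - ds t) = w at *
    generalize deriv qm t = a at *
    generalize deriv qs t = b at *
    generalize e t = e₀ at *
    generalize fm t + Kp *ᵥ γ = f at *
    simp only [dotProduct_add, dotProduct_sub, sub_dotProduct]
    linarith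
  · have hS1 : Φ t ≤ (1 + Φ t) ^ 2 := by nlinarith
    have hS2 : 1 ≤ (1 + Φ t) ^ 2 := by nlinarith
    have hS3 : Φ t ^ 2 ≤ (1 + Φ t) ^ 2 := by nlinarith
    have hab : deriv qm t ⬝ᵥ deriv qm t + deriv qs t ⬝ᵥ deriv qs t ≤ 4 / ε * (1 + Φ t) ^ 2 := by
      rw [div_mul_eq_mul_div, le_div_iff₀ hε]
      linarith
    have hg : gm t + gs t ≤ (1 + Φ t) ^ 2 / η := by
      rw [le_div_iff₀ hη0]
      linarith
    have hrr : r t ^ 2 ≤ 1 / (δ * k) ^ 2 * (1 + Φ t) ^ 2 := by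
      rw [div_mul_eq_mul_div, one_mul, le_div_iff₀ (by positivity), ← mul_pow, mul_comm (r t)]
      exact (pow_le_pow_left₀ (mul_nonneg (by positivity) (hr0 t)) hΦr 2).trans hS3
    have u1 : deriv qm t ⬝ᵥ Mm (qm t) *ᵥ deriv qm t ≤ LM * (4 / ε * (1 + Φ t) ^ 2) :=
      (hMm _ _).2.trans (by gcongr; linarith)
    have u2 : deriv qs t ⬝ᵥ Ms (qs t) *ᵥ deriv qs t ≤ lM * (4 / ε * (1 + Φ t) ^ 2) :=
      (hMs _ _).2.trans (by gcongr; linarith)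
    have u3 : e t ⬝ᵥ Kp *ᵥ e t ≤ kp * (1 / (δ * k) ^ 2 * (1 + Φ t) ^ 2) :=
      (hKpu _).trans (by gcongr; linarith [hrsq t])
    have u4 : Um t + Us t ≤ (hM + hS) * ((1 + Φ t) ^ 2 / η) := by
      have v1 : Um t ≤ hM * gm t := (hUmb t).2
      have v2 : Us t ≤ hS * gs t := (hUsb t).2
      have v3 : hM * (gm t + gs t) ≤ hM * ((1 + Φ t) ^ 2 / η) := by gcongr
      have v4 : hS * (gm t + gs t) ≤ hS * ((1 + Φ t) ^ 2 / η) := by gcongr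
      linarith [mul_nonneg hhM.le (hgs0 t), mul_nonneg hhS.le (hgm0 t)]
    have u5 : (1 + η) * (Um t + Us t) ≤ (1 + η) * ((hM + hS) * ((1 + Φ t) ^ 2 / η)) := by gcongr
    have u6 : δ * X t ≤ δ * (lM / 2 * ((1 + Φ t) ^ 2 + 4 / ε * (1 + Φ t) ^ 2)) := by
      gcongr
      exact hXt.2.trans (by gcongr; linarith)
    have u7 : 0 ≤ lm * (1 + Φ t) ^ 2 := by positivity
    have u8 : (1 + η) * ((hM + hS) * ((1 + Φ t) ^ 2 / η))
        = (1 + η) * ((hM + hS) / η) * (1 + Φ t) ^ 2 := by ring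
    dsimp only
    linarith
  · have v1 := (hMs (qs t) (deriv qs t)).1
    have v2 := hnn hKp (e t)
    have v3 : 0 ≤ (1 + η) * (Um t + Us t) :=
      mul_nonneg (by positivity) (add_nonneg (hUmb t).1 (hUsb t).1)
    have v4 := mul_le_mul_of_nonneg_left hXt.1 hδ0.le
    have v5 := mul_le_mul_of_nonneg_right hδl
      (show 0 ≤ 1 + deriv qs t ⬝ᵥ deriv qs t by linarith)
    have v6 : 0 ≤ (LM + lM) * (4 / ε) + kp * (1 / (δ * k) ^ 2) + (1 + η) * ((hM + hS) / η)
      + δ * (lM / 2 * (1 + 4 / ε)) := by positivity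
    dsimp only
    linarith

/-- Theorem 1, Claim 2 (Round-Robin, bounded forces): under properties P1–P3, the
closed-loop RR dynamics with measurable bounded delays, and feasibility of the LMIs
Π_i < 0, if the external forces f_m, f_{s1}, …, f_{sN} are bounded on [t₀,∞) then
the velocities q̇_m and q̇_{si} are bounded on [t₀,∞). -/
theorem rr_bounded_forces_bounded_velocities
    {n N : ℕ} (hn : 1 ≤ n) (hN : 2 ≤ N) (t₀ : ℝ)
    (Mm : (Fin n → ℝ) → Matrix (Fin n) (Fin n) ℝ)
    (Ms : Fin N → (Fin n → ℝ) → Matrix (Fin n) (Fin n) ℝ)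
    (Cm : (Fin n → ℝ) → (Fin n → ℝ) → Matrix (Fin n) (Fin n) ℝ)
    (Cs : Fin N → (Fin n → ℝ) → (Fin n → ℝ) → Matrix (Fin n) (Fin n) ℝ)
    -- robot properties P1–P3
    (hP1m : PropP1 Mm) (hP1s : ∀ i, PropP1 (Ms i))
    (hP2m : PropP2 Mm Cm) (hP2s : ∀ i, PropP2 (Ms i) (Cs i))
    (hP3m : PropP3 Cm) (hP3s : ∀ i, PropP3 (Cs i))
    -- measurable bounded delays
    (hM hS : ℝ) (hhM : 0 < hM) (hMS : hM ≤ hS)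
    (dm : ℝ → ℝ) (ds : Fin N → ℝ → ℝ)
    (hdmMeas : Measurable dm) (hdsMeas : ∀ i, Measurable (ds i))
    (hdm : ∀ t ≥ t₀, 0 ≤ dm t ∧ dm t ≤ hM)
    (hds : ∀ i, ∀ t ≥ t₀, 0 ≤ ds i t ∧ ds i t ≤ hS)
    -- controller gains and formation offsets
    (Kp Kd : Fin N → Matrix (Fin n) (Fin n) ℝ)
    (hKp : ∀ i, (Kp i).PosDef) (hKd : ∀ i, (Kd i).PosDef)
    (γ : Fin N → Fin n → ℝ)
    -- trajectories and external forces
    (qm : ℝ → Fin n → ℝ) (qs : Fin N → ℝ → Fin n → ℝ)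
    (hqm : ContDiff ℝ 2 qm) (hqs : ∀ i, ContDiff ℝ 2 (qs i))
    (fm : ℝ → Fin n → ℝ) (fs : Fin N → ℝ → Fin n → ℝ)
    -- closed-loop RR dynamics for all t ≥ t₀
    (hdynm : ∀ t ≥ t₀, fm t =
      (Mm (qm t)).mulVec (deriv (deriv qm) t)
      + (Cm (qm t) (deriv qm t)).mulVec (deriv qm t)
      + (N : ℝ)⁻¹ • ∑ i, ((Kp i).mulVec (qm t - qs i (t - ds i t))
          + (Kd i).mulVec (deriv qm t)))
    (hdyns : ∀ i, ∀ t ≥ t₀, fs i t =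
      (Ms i (qs i t)).mulVec (deriv (deriv (qs i)) t)
      + (Cs i (qs i t) (deriv (qs i) t)).mulVec (deriv (qs i) t)
      + (Kd i).mulVec (deriv (qs i) t)
      + (Kp i).mulVec ((qs i t - γ i) - qm (t - dm t)))
    -- LMI feasibility condition: Π_i negative definite
    (Rm : Matrix (Fin n) (Fin n) ℝ) (Rs : Fin N → Matrix (Fin n) (Fin n) ℝ)
    (hRm : Rm.PosDef) (hRs : ∀ i, (Rs i).PosDef)
    (hLMI : ∀ i, (-(PiRR hM hS (Kp i) (Kd i) Rm (Rs i))).PosDef)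
    -- external forces in L^∞ on [t₀, ∞)
    (hforces : ∃ Δ : ℝ, ∀ t ≥ t₀, ‖fm t‖ ≤ Δ ∧ ∀ i, ‖fs i t‖ ≤ Δ) :
    ∃ B : ℝ, ∀ t ≥ t₀, ‖deriv qm t‖ ≤ B ∧ ∀ i, ‖deriv (qs i) t‖ ≤ B := by
  obtain ⟨Δ, hΔ⟩ := hforces
  have hpair := fun i => exists_pair_functional hP1m (hP1s i) (hP2s i) (hP3s i) hhM
    (hhM.trans_le hMS) hdm (hds i) (hKp i) (hKd i) (γ i) hqm (hqs i) (hdyns i) hRm (hRs i)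
    (hLMI i) (fun t ht => (hΔ t ht).1) fun t ht => (hΔ t ht).2 i
  choose Z D Φ A C c hc hZ hpr using hpair
  obtain ⟨lm, _, hlm, -, hMm⟩ := hP1m.exists_bounds
  have hN0 : (0 : ℝ) < N := by positivity
  set a : ℝ → ℝ := fun t => deriv qm t ⬝ᵥ Mm (qm t) *ᵥ deriv qm t with ha
  have hW : ∀ t, HasDerivAt (fun s => N * a s + ∑ i, Z i s) (N * (2 * (deriv qm t ⬝ᵥ
      (Mm (qm t) *ᵥ deriv (deriv qm) t + Cm (qm t) (deriv qm t) *ᵥ deriv qm t))) + ∑ i, D i t) t :=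
    fun t => ((hasDerivAt_kinetic hP1m hP2m hqm t).const_mul _).add
      (HasDerivAt.fun_sum fun i _ => hZ i t)
  set W : ℝ → ℝ := fun s => N * a s + ∑ i, Z i s with hWdef
  set W' : ℝ → ℝ := fun t => N * (2 * (deriv qm t ⬝ᵥ
      (Mm (qm t) *ᵥ deriv (deriv qm) t + Cm (qm t) (deriv qm t) *ᵥ deriv qm t))) + ∑ i, D i t
  have hWsum : ∀ t, W t = ∑ i, (a t + Z i t) := fun t => by
    simp [hWdef, Finset.sum_add_distrib]
  have hdecay : ∀ t ≥ t₀, W' t ≤ ∑ i, C i - ∑ i, Φ i t := by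
    intro t ht
    have hτ : (N : ℝ) * (2 * (deriv qm t ⬝ᵥ
        (Mm (qm t) *ᵥ deriv (deriv qm) t + Cm (qm t) (deriv qm t) *ᵥ deriv qm t)))
        = ∑ i, 2 * (deriv qm t ⬝ᵥ (fm t - (Kp i *ᵥ (qm t - qs i (t - ds i t))
          + Kd i *ᵥ deriv qm t))) := by
      have h' : Mm (qm t) *ᵥ deriv (deriv qm) t + Cm (qm t) (deriv qm t) *ᵥ deriv qm t
          = fm t - (N : ℝ)⁻¹ • ∑ i, (Kp i *ᵥ (qm t - qs i (t - ds i t))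
            + Kd i *ᵥ deriv qm t) :=
          eq_sub_of_add_eq (hdynm t ht).symm
      rw [h']
      simp only [dotProduct_sub, dotProduct_smul, dotProduct_sum, smul_eq_mul, mul_sub,
        Finset.sum_sub_distrib, Finset.sum_const, Finset.card_univ, Fintype.card_fin, nsmul_eq_mul,
        ← Finset.mul_sum]
      field_simp
    change _ * _ + _ ≤ _
    rw [hτ, ← Finset.sum_add_distrib, ← Finset.sum_sub_distrib]
    exact Finset.sum_le_sum fun i _ => by linarith [(hpr i t ht).2.1]
  have hup : ∀ t ≥ t₀, W t ≤ (∑ i, |A i|) * (1 + ∑ i, Φ i t) ^ 2 := by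
    intro t ht
    rw [hWsum, Finset.sum_mul]
    refine Finset.sum_le_sum fun i _ => (hpr i t ht).2.2.1.trans ?_
    have h0 := (hpr i t ht).1
    have h1 : Φ i t ≤ ∑ i, Φ i t :=
      Finset.single_le_sum (f := fun i => Φ i t) (fun j _ => (hpr j t ht).1) (Finset.mem_univ i)
    gcongr
    exact le_abs_self _
  set L : ℝ := max (W t₀) ((∑ i, |A i|) * (1 + |∑ i, C i|) ^ 2 + 1) with hL
  have hWL : ∀ t ≥ t₀, W t ≤ L := by
    intro t ht
    refine image_le_of_deriv_right_lt_deriv_boundary (f' := W') (B := fun _ => L) (B' := fun _ => 0)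
      (fun s _ => (hW s).continuousAt.continuousWithinAt) (fun s _ => (hW s).hasDerivWithinAt)
      (le_max_left _ _) (fun s => hasDerivAt_const s L) (fun s hs hsL => ?_) ⟨ht, le_rfl⟩
    by_contra! hcon
    have h1 : ∑ i, Φ i s ≤ |∑ i, C i| :=
      (sub_nonneg.1 (hcon.trans (hdecay s hs.1))).trans (le_abs_self _)
    have h2 : 0 ≤ ∑ i, Φ i s := Finset.sum_nonneg fun i _ => (hpr i s hs.1).1
    have h3 : (∑ i, |A i|) * (1 + ∑ i, Φ i s) ^ 2 ≤ (∑ i, |A i|) * (1 + |∑ i, C i|) ^ 2 := by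
      gcongr
    have h4 : (∑ i, |A i|) * (1 + |∑ i, C i|) ^ 2 + 1 ≤ L := le_max_right _ _
    linarith [hup s hs.1]
  have hE : ∀ t ≥ t₀, N * (lm * (deriv qm t ⬝ᵥ deriv qm t))
      + ∑ i, c i * (deriv (qs i) t ⬝ᵥ deriv (qs i) t) ≤ L + ∑ i, A i := by
    intro t ht
    have h1 : N * (lm * (deriv qm t ⬝ᵥ deriv qm t)) ≤ N * a t := by
      gcongr
      exact (hMm _ _).1
    have h2 : ∑ i, c i * (deriv (qs i) t ⬝ᵥ deriv (qs i) t) ≤ ∑ i, (Z i t + A i) :=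
      Finset.sum_le_sum fun i _ => (hpr i t ht).2.2.2
    rw [Finset.sum_add_distrib] at h2
    have h3 : N * a t + ∑ i, Z i t ≤ L := hWL t ht
    linarith
  set E : ℝ := L + ∑ i, A i
  have hnorm : ∀ {k : ℝ} {x : Fin n → ℝ}, 0 < k → k * (x ⬝ᵥ x) ≤ E → ‖x‖ ≤ 1 + |E| / k := by
    intro k x hk hx
    have h1 : ‖x‖ ^ 2 ≤ |E| / k := by
      rw [le_div_iff₀ hk, mul_comm]
      exact (mul_le_mul_of_nonneg_left (norm_sq_le_dotProduct x) hk.le).trans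
        (hx.trans (le_abs_self E))
    nlinarith [sq_nonneg (‖x‖ - 1)]
  have hcs : ∀ t i, 0 ≤ c i * (deriv (qs i) t ⬝ᵥ deriv (qs i) t) := fun t i =>
    mul_nonneg (hc i).le (dotProduct_self_nonneg_real _)
  have hterm : ∀ i, |E| / c i ≤ ∑ i, |E| / c i := fun i =>
    Finset.single_le_sum (f := fun i => |E| / c i)
      (fun j _ => div_nonneg (abs_nonneg E) (hc j).le) (Finset.mem_univ i)
  have hsum0 : 0 ≤ ∑ i, |E| / c i :=
    Finset.sum_nonneg fun j _ => div_nonneg (abs_nonneg E) (hc j).le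
  refine ⟨1 + |E| / (N * lm) + ∑ i, |E| / c i, fun t ht => ⟨?_, fun i => ?_⟩⟩
  · have h := hnorm (k := N * lm) (x := deriv qm t) (by positivity) (by
      have h0 := Finset.sum_nonneg fun i (_ : i ∈ Finset.univ) => hcs t i
      linarith [hE t ht])
    linarith
  · have h := hnorm (hc i) (x := deriv (qs i) t) (by
      have h0 : 0 ≤ N * (lm * (deriv qm t ⬝ᵥ deriv qm t)) :=
        mul_nonneg hN0.le (mul_nonneg hlm.le (dotProduct_self_nonneg_real _))
      have h1 := Finset.single_le_sum (fun j _ => hcs t j) (Finset.mem_univ i)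
      linarith [hE t ht])
    have h2 : 0 ≤ |E| / (N * lm) := by positivity
    linarith [hterm i]
end
end

section
/- Steady-state force reflection (Theorem 1, Claim 4): suppose the closed-loop RR dynamics hold for all t ≥ t₀ and that the positions are in steady state, i.e. q_m and each q_{si} are constant on [t₀ − h_S, ∞). Then for all t ≥ t₀: f_m(t) = (1/N)·Σ_{i=1}^N K_i^p·(q_m − q_{si}) and f_{si}(t) = K_i^p·(q_{si} − γ_i − q_m), and hence f_m(t) + (1/N)·Σ_{i=1}^N f_{si}(t) = −(1/N)·Σ_{i=1}^N K_i^p·γ_i. In particular, if Σ_{i=1}^N K_i^p·γ_i = 0 (e.g. when all proportional gains K_i^p are equal and Σ_{i=1}^N γ_i = 0), then the human force equals the negative mean environmental force: f_m(t) = −(1/N)·Σ_{i=1}^N f_{si}(t). -/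
open Matrix MeasureTheory Filter Set Finset

noncomputable section

theorem deriv_eq_zero_of_forall_gt_eq {E : Type*} [NormedAddCommGroup E] [NormedSpace ℝ E]
    {f : ℝ → E} {a : ℝ} {c : E} (h : ∀ s > a, f s = c) {t : ℝ} (ht : a < t) :
    deriv f t = 0 := by
  have hf : f =ᶠ[nhds t] fun _ => c := (eventually_gt_nhds ht).mono h
  rw [hf.deriv_eq, deriv_const]

/-- Theorem 1, Claim 4 (steady-state force reflection): if the closed-loop RR
dynamics hold for t ≥ t₀ and the positions are constant on [t₀ − h_S, ∞), then
f_m(t) = (1/N)·Σᵢ Kᵢᵖ(q_m − q_{si}), f_{si}(t) = Kᵢᵖ(q_{si} − γᵢ − q_m), hence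
f_m(t) + (1/N)·Σᵢ f_{si}(t) = −(1/N)·Σᵢ Kᵢᵖ·γᵢ; in particular if Σᵢ Kᵢᵖ·γᵢ = 0
then f_m(t) = −(1/N)·Σᵢ f_{si}(t). -/
theorem rr_steady_state_force_reflection
    {n N : ℕ} (hn : 1 ≤ n) (hN : 2 ≤ N) (t₀ : ℝ)
    (Mm : (Fin n → ℝ) → Matrix (Fin n) (Fin n) ℝ)
    (Ms : Fin N → (Fin n → ℝ) → Matrix (Fin n) (Fin n) ℝ)
    (Cm : (Fin n → ℝ) → (Fin n → ℝ) → Matrix (Fin n) (Fin n) ℝ)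
    (Cs : Fin N → (Fin n → ℝ) → (Fin n → ℝ) → Matrix (Fin n) (Fin n) ℝ)
    -- measurable bounded delays
    (hM hS : ℝ) (hhM : 0 < hM) (hMS : hM ≤ hS)
    (dm : ℝ → ℝ) (ds : Fin N → ℝ → ℝ)
    (hdmMeas : Measurable dm) (hdsMeas : ∀ i, Measurable (ds i))
    (hdm : ∀ t ≥ t₀, 0 ≤ dm t ∧ dm t ≤ hM)
    (hds : ∀ i, ∀ t ≥ t₀, 0 ≤ ds i t ∧ ds i t ≤ hS)
    -- controller gains and formation offsets
    (Kp Kd : Fin N → Matrix (Fin n) (Fin n) ℝ)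
    (hKp : ∀ i, (Kp i).PosDef) (hKd : ∀ i, (Kd i).PosDef)
    (γ : Fin N → Fin n → ℝ)
    -- twice differentiable trajectories
    (qm : ℝ → Fin n → ℝ) (qs : Fin N → ℝ → Fin n → ℝ)
    (hqm : Differentiable ℝ qm ∧ Differentiable ℝ (deriv qm))
    (hqs : ∀ i, Differentiable ℝ (qs i) ∧ Differentiable ℝ (deriv (qs i)))
    (fm : ℝ → Fin n → ℝ) (fs : Fin N → ℝ → Fin n → ℝ)
    -- closed-loop RR dynamics for all t ≥ t₀
    (hdynm : ∀ t ≥ t₀, fm t =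
      (Mm (qm t)).mulVec (deriv (deriv qm) t)
      + (Cm (qm t) (deriv qm t)).mulVec (deriv qm t)
      + (N : ℝ)⁻¹ • ∑ i, ((Kp i).mulVec (qm t - qs i (t - ds i t))
          + (Kd i).mulVec (deriv qm t)))
    (hdyns : ∀ i, ∀ t ≥ t₀, fs i t =
      (Ms i (qs i t)).mulVec (deriv (deriv (qs i)) t)
      + (Cs i (qs i t) (deriv (qs i) t)).mulVec (deriv (qs i) t)
      + (Kd i).mulVec (deriv (qs i) t)
      + (Kp i).mulVec ((qs i t - γ i) - qm (t - dm t)))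
    -- steady state: positions constant on [t₀ − h_S, ∞)
    (hsteady : ∀ t ≥ t₀ - hS, qm t = qm t₀ ∧ ∀ i, qs i t = qs i t₀) :
    ∀ t ≥ t₀,
      fm t = (N : ℝ)⁻¹ • ∑ i, (Kp i).mulVec (qm t₀ - qs i t₀) ∧
      (∀ i, fs i t = (Kp i).mulVec (qs i t₀ - γ i - qm t₀)) ∧
      fm t + (N : ℝ)⁻¹ • ∑ i, fs i t = -((N : ℝ)⁻¹) • ∑ i, (Kp i).mulVec (γ i) ∧
      ((∑ i, (Kp i).mulVec (γ i)) = 0 →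
        fm t = -((N : ℝ)⁻¹) • ∑ i, fs i t) := by
  intro t ht
  have hS_pos : 0 < hS := hhM.trans_le hMS
  have ht_gt : t₀ - hS < t := by linarith
  have hqm_deriv : ∀ s > t₀ - hS, deriv qm s = 0 := fun s hs =>
    deriv_eq_zero_of_forall_gt_eq (fun r hr => (hsteady r hr.le).1) hs
  have hqs_deriv : ∀ i, ∀ s > t₀ - hS, deriv (qs i) s = 0 := fun i s hs =>
    deriv_eq_zero_of_forall_gt_eq (fun r hr => (hsteady r hr.le).2 i) hs
  have hfm : fm t = (N : ℝ)⁻¹ • ∑ i, (Kp i).mulVec (qm t₀ - qs i t₀) := by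
    have hdelay : ∀ i, qs i (t - ds i t) = qs i t₀ := fun i =>
      (hsteady _ (by linarith [(hds i t ht).2])).2 i
    simp [hdynm t ht, deriv_eq_zero_of_forall_gt_eq hqm_deriv ht_gt, hqm_deriv t ht_gt,
      hdelay, (hsteady t ht_gt.le).1]
  have hfs : ∀ i, fs i t = (Kp i).mulVec (qs i t₀ - γ i - qm t₀) := by
    intro i
    have hdelay : qm (t - dm t) = qm t₀ :=
      (hsteady _ (by linarith [(hdm t ht).2])).1
    simp [hdyns i t ht, deriv_eq_zero_of_forall_gt_eq (hqs_deriv i) ht_gt,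
      hqs_deriv i t ht_gt, hdelay, (hsteady t ht_gt.le).2 i]
  have hsum : fm t + (N : ℝ)⁻¹ • ∑ i, fs i t
      = -((N : ℝ)⁻¹) • ∑ i, (Kp i).mulVec (γ i) := by
    rw [hfm, ← smul_add, ← Finset.sum_add_distrib, neg_smul, ← smul_neg,
      ← Finset.sum_neg_distrib]
    refine congrArg _ (Finset.sum_congr rfl fun i _ => ?_)
    rw [hfs, ← mulVec_add, ← mulVec_neg]
    congr 1
    abel
  refine ⟨hfm, hfs, hsum, fun hγ => ?_⟩
  rw [hγ, smul_zero] at hsum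
  rw [neg_smul]
  exact eq_neg_of_add_eq_zero_left hsum
end
end
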